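/- Assume the standing assumptions and α > 0. Then for every Y ∈ 𝒴 and every Z ∈ ℝ^{m×n}: ‖X(Y₊(Z), Z) − X(Y(Z), Z)‖_F ≤ ω · ‖Y₊(Z) − Y‖_F, where Y₊(Z) := proj_𝒴(Y + α(G(X(Y,Z)) − εY)), Y(Z) is a maximizer of d(·,Z) over 𝒴, σ₂ := 2R_X/(r−μ_ρ), and ω := (1/√(r−μ_ρ))·((1 + (2σ₂R_X + ε)α)/(√ε·α)). -/

import Mathlib

open Matrix

noncomputable section

/-- Frobenius inner product `⟨A,B⟩ = tr(AᵀB)`. -/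
def frobInner {m n : ℕ} (A B : Matrix (Fin m) (Fin n) ℝ) : ℝ := (Aᵀ * B).trace

/-- Frobenius norm. -/
def frobNorm {m n : ℕ} (A : Matrix (Fin m) (Fin n) ℝ) : ℝ := Real.sqrt (frobInner A A)

/-- Spectral (operator) norm of a matrix. -/
def specNorm {m n : ℕ} (A : Matrix (Fin m) (Fin n) ℝ) : ℝ :=
  ‖LinearMap.toContinuousLinearMap (Matrix.toEuclideanLin A)‖

/-- `G(X) := XᵀX − Iₙ`. -/
def Gm {m n : ℕ} (X : Matrix (Fin m) (Fin n) ℝ) : Matrix (Fin n) (Fin n) ℝ := Xᵀ * X - 1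

/-- `gradl` is the (Fréchet) gradient of `ℓ` w.r.t. the Frobenius inner product. -/
def IsGradientOf {m n : ℕ} (gradl : Matrix (Fin m) (Fin n) ℝ → Matrix (Fin m) (Fin n) ℝ)
    (ℓ : Matrix (Fin m) (Fin n) ℝ → ℝ) : Prop :=
  ∀ X : Matrix (Fin m) (Fin n) ℝ, ∀ c : ℝ, 0 < c → ∃ δ : ℝ, 0 < δ ∧
    ∀ H : Matrix (Fin m) (Fin n) ℝ, frobNorm H ≤ δ →
      |ℓ (X + H) - ℓ X - frobInner (gradl X) H| ≤ c * frobNorm H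

/-- Augmented Lagrangian `ℒ_ρ(X,Y) = f(X) + ⟨Y, G(X)⟩ + (ρ/2)‖G(X)‖_F²` with `f = ℓ + g`. -/
def Lag {m n : ℕ} (ℓ g : Matrix (Fin m) (Fin n) ℝ → ℝ) (ρ : ℝ)
    (X : Matrix (Fin m) (Fin n) ℝ) (Y : Matrix (Fin n) (Fin n) ℝ) : ℝ :=
  ℓ X + g X + frobInner Y (Gm X) + ρ / 2 * frobNorm (Gm X) ^ 2

/-- `F(X,Y,Z) = ℒ_ρ(X,Y) − (ε/2)‖Y‖_F² + (r/2)‖X−Z‖_F²`. -/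
def Ffun {m n : ℕ} (ℓ g : Matrix (Fin m) (Fin n) ℝ → ℝ) (ρ r ε : ℝ)
    (X : Matrix (Fin m) (Fin n) ℝ) (Y : Matrix (Fin n) (Fin n) ℝ)
    (Z : Matrix (Fin m) (Fin n) ℝ) : ℝ :=
  Lag ℓ g ρ X Y - ε / 2 * frobNorm Y ^ 2 + r / 2 * frobNorm (X - Z) ^ 2

/-- Dual function `d(Y,Z) = min_{X ∈ 𝒳} F(X,Y,Z)`. -/
def dfun {m n : ℕ} (𝒳 : Set (Matrix (Fin m) (Fin n) ℝ))
    (ℓ g : Matrix (Fin m) (Fin n) ℝ → ℝ) (ρ r ε : ℝ)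
    (Y : Matrix (Fin n) (Fin n) ℝ) (Z : Matrix (Fin m) (Fin n) ℝ) : ℝ :=
  sInf ((fun X => Ffun ℓ g ρ r ε X Y Z) '' 𝒳)

/-- Proximal function `p(Z) = max_{Y ∈ 𝒴} d(Y,Z)`. -/
def pfun {m n : ℕ} (𝒳 : Set (Matrix (Fin m) (Fin n) ℝ))
    (𝒴 : Set (Matrix (Fin n) (Fin n) ℝ))
    (ℓ g : Matrix (Fin m) (Fin n) ℝ → ℝ) (ρ r ε : ℝ)
    (Z : Matrix (Fin m) (Fin n) ℝ) : ℝ :=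
  sSup ((fun Y => dfun 𝒳 ℓ g ρ r ε Y Z) '' 𝒴)

/-- Potential function `Φ(X,Y,Z) = F(X,Y,Z) − 2d(Y,Z) + 2p(Z)`. -/
def Phi {m n : ℕ} (𝒳 : Set (Matrix (Fin m) (Fin n) ℝ))
    (𝒴 : Set (Matrix (Fin n) (Fin n) ℝ))
    (ℓ g : Matrix (Fin m) (Fin n) ℝ → ℝ) (ρ r ε : ℝ)
    (X : Matrix (Fin m) (Fin n) ℝ) (Y : Matrix (Fin n) (Fin n) ℝ)
    (Z : Matrix (Fin m) (Fin n) ℝ) : ℝ :=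
  Ffun ℓ g ρ r ε X Y Z - 2 * dfun 𝒳 ℓ g ρ r ε Y Z + 2 * pfun 𝒳 𝒴 ℓ g ρ r ε Z

/-- Linearized augmented Lagrangian `ℒ_{X̄,λ}(X,Y)`. -/
def LinLag {m n : ℕ} (ℓ g : Matrix (Fin m) (Fin n) ℝ → ℝ)
    (gradl : Matrix (Fin m) (Fin n) ℝ → Matrix (Fin m) (Fin n) ℝ) (ρ lam : ℝ)
    (Xb X : Matrix (Fin m) (Fin n) ℝ) (Y : Matrix (Fin n) (Fin n) ℝ) : ℝ :=
  ℓ Xb + frobInner Y (Gm Xb) + ρ / 2 * frobNorm (Gm Xb) ^ 2 + g X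
    + frobInner (gradl Xb) (X - Xb)
    + frobInner ((2 : ℝ) • (Xb * (Y + ρ • Gm Xb))) (X - Xb)
    + 1 / (2 * lam) * frobNorm (X - Xb) ^ 2

section FrobeniusGeometry

variable {m n k : ℕ}

lemma frobInner_eq_sum (A B : Matrix (Fin m) (Fin n) ℝ) :
    frobInner A B = ∑ j, ∑ i, A i j * B i j := by
  simp [frobInner, Matrix.trace, Matrix.mul_apply]

lemma frobInner_comm (A B : Matrix (Fin m) (Fin n) ℝ) : frobInner A B = frobInner B A := by
  simp only [frobInner_eq_sum, mul_comm]

lemma frobInner_add_left (A B C : Matrix (Fin m) (Fin n) ℝ) :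
    frobInner (A + B) C = frobInner A C + frobInner B C := by
  simp [frobInner, Matrix.add_mul]

lemma frobInner_sub_left (A B C : Matrix (Fin m) (Fin n) ℝ) :
    frobInner (A - B) C = frobInner A C - frobInner B C := by
  simp [frobInner, Matrix.sub_mul]

lemma frobInner_smul_left (c : ℝ) (A B : Matrix (Fin m) (Fin n) ℝ) :
    frobInner (c • A) B = c * frobInner A B := by
  simp [frobInner]

lemma frobInner_add_right (A B C : Matrix (Fin m) (Fin n) ℝ) :
    frobInner A (B + C) = frobInner A B + frobInner A C := by
  simp [frobInner, Matrix.mul_add]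

lemma frobInner_sub_right (A B C : Matrix (Fin m) (Fin n) ℝ) :
    frobInner A (B - C) = frobInner A B - frobInner A C := by
  simp [frobInner, Matrix.mul_sub]

lemma frobInner_smul_right (c : ℝ) (A B : Matrix (Fin m) (Fin n) ℝ) :
    frobInner A (c • B) = c * frobInner A B := by
  simp [frobInner]

lemma frobInner_self_nonneg (A : Matrix (Fin m) (Fin n) ℝ) : 0 ≤ frobInner A A := by
  rw [frobInner_eq_sum]
  exact Finset.sum_nonneg fun j _ => Finset.sum_nonneg fun i _ => mul_self_nonneg _

lemma frobNorm_nonneg (A : Matrix (Fin m) (Fin n) ℝ) : 0 ≤ frobNorm A := Real.sqrt_nonneg _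

lemma frobNorm_sq (A : Matrix (Fin m) (Fin n) ℝ) : frobNorm A ^ 2 = frobInner A A :=
  Real.sq_sqrt (frobInner_self_nonneg A)

lemma frobInner_le_mul_frobNorm (A B : Matrix (Fin m) (Fin n) ℝ) :
    frobInner A B ≤ frobNorm A * frobNorm B := by
  have h := Real.sum_mul_le_sqrt_mul_sqrt (Finset.univ : Finset (Fin n × Fin m))
    (fun p => A p.2 p.1) (fun p => B p.2 p.1)
  simpa [frobNorm, frobInner_eq_sum, Fintype.sum_prod_type, pow_two] using h

lemma frobNorm_add_le (A B : Matrix (Fin m) (Fin n) ℝ) :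
    frobNorm (A + B) ≤ frobNorm A + frobNorm B := by
  refine le_of_sq_le_sq ?_ (add_nonneg (frobNorm_nonneg A) (frobNorm_nonneg B))
  have h := frobInner_le_mul_frobNorm A B
  rw [frobNorm_sq, add_sq, frobNorm_sq, frobNorm_sq]
  simp only [frobInner_add_left, frobInner_add_right, frobInner_comm B A]
  linarith

lemma frobNorm_smul (c : ℝ) (A : Matrix (Fin m) (Fin n) ℝ) :
    frobNorm (c • A) = |c| * frobNorm A := by
  rw [frobNorm, frobInner_smul_left, frobInner_smul_right, ← mul_assoc,
    Real.sqrt_mul (mul_self_nonneg c), Real.sqrt_mul_self_eq_abs, frobNorm]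

lemma frobNorm_neg (A : Matrix (Fin m) (Fin n) ℝ) : frobNorm (-A) = frobNorm A := by
  simpa using frobNorm_smul (-1) A

lemma frobNorm_transpose (A : Matrix (Fin m) (Fin n) ℝ) : frobNorm Aᵀ = frobNorm A := by
  rw [frobNorm, frobNorm, frobInner, frobInner, Matrix.transpose_transpose, Matrix.trace_mul_comm]

lemma frobNorm_mul_le_specNorm_mul (A : Matrix (Fin m) (Fin n) ℝ) (B : Matrix (Fin n) (Fin k) ℝ) :
    frobNorm (A * B) ≤ specNorm A * frobNorm B := by
  have hs : 0 ≤ specNorm A := norm_nonneg _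
  refine le_of_sq_le_sq ?_ (mul_nonneg hs (frobNorm_nonneg B))
  rw [mul_pow, frobNorm_sq, frobNorm_sq, frobInner_eq_sum, frobInner_eq_sum, Finset.mul_sum]
  refine Finset.sum_le_sum fun j _ => ?_
  have h := (LinearMap.toContinuousLinearMap (Matrix.toEuclideanLin A)).le_opNorm
    (WithLp.toLp 2 fun i => B i j)
  have h2 := pow_le_pow_left₀ (norm_nonneg _) h 2
  rw [mul_pow, EuclideanSpace.real_norm_sq_eq, EuclideanSpace.real_norm_sq_eq] at h2
  simpa [specNorm, Matrix.mulVec, dotProduct, Matrix.mul_apply, pow_two] using h2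

lemma frobInner_mul_left (A : Matrix (Fin m) (Fin n) ℝ) (B : Matrix (Fin n) (Fin k) ℝ)
    (C : Matrix (Fin m) (Fin k) ℝ) : frobInner (A * B) C = frobInner B (Aᵀ * C) := by
  simp [frobInner, Matrix.transpose_mul, Matrix.mul_assoc]

lemma frobNorm_transpose_mul_le_specNorm_mul (A : Matrix (Fin m) (Fin n) ℝ)
    (B : Matrix (Fin m) (Fin k) ℝ) : frobNorm (Aᵀ * B) ≤ specNorm A * frobNorm B := by
  have h1 : frobNorm (Aᵀ * B) ^ 2 ≤ specNorm A * frobNorm (Aᵀ * B) * frobNorm B := by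
    rw [frobNorm_sq, ← frobInner_mul_left]
    exact (frobInner_le_mul_frobNorm _ _).trans
      (mul_le_mul_of_nonneg_right (frobNorm_mul_le_specNorm_mul _ _) (frobNorm_nonneg _))
  rcases (frobNorm_nonneg (Aᵀ * B)).eq_or_lt with h | h
  · rw [← h]
    exact mul_nonneg (norm_nonneg _) (frobNorm_nonneg _)
  · nlinarith

lemma specNorm_le_frobNorm (A : Matrix (Fin m) (Fin n) ℝ) : specNorm A ≤ frobNorm A := by
  refine ContinuousLinearMap.opNorm_le_bound _ (frobNorm_nonneg A) fun x => ?_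
  refine le_of_sq_le_sq ?_ (mul_nonneg (frobNorm_nonneg A) (norm_nonneg x))
  rw [mul_pow, frobNorm_sq, EuclideanSpace.real_norm_sq_eq, EuclideanSpace.real_norm_sq_eq,
    frobInner_eq_sum, Finset.sum_comm, Finset.sum_mul]
  refine Finset.sum_le_sum fun i _ => ?_
  simpa [Matrix.mulVec, dotProduct, pow_two] using
    Finset.sum_mul_sq_le_sq_mul_sq Finset.univ (A i) x

lemma frobNorm_transpose_mul_self_le (H : Matrix (Fin m) (Fin n) ℝ) :
    frobNorm (Hᵀ * H) ≤ frobNorm H ^ 2 :=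
  (frobNorm_transpose_mul_le_specNorm_mul H H).trans <| by
    rw [pow_two]
    exact mul_le_mul_of_nonneg_right (specNorm_le_frobNorm H) (frobNorm_nonneg H)

lemma frobInner_gram_nonneg (P H : Matrix (Fin m) (Fin n) ℝ) :
    0 ≤ frobInner (Pᵀ * P) (Hᵀ * H) := by
  have h : frobInner (Pᵀ * P) (Hᵀ * H) = frobInner (P * Hᵀ) (P * Hᵀ) := by
    simp only [frobInner, Matrix.transpose_mul, Matrix.transpose_transpose]
    rw [Matrix.mul_assoc H, Matrix.trace_mul_comm H]
    simp only [Matrix.mul_assoc]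
  rw [h]
  exact frobInner_self_nonneg _

end FrobeniusGeometry

/-- A real number dominated by arbitrarily small multiples of another one is nonpositive. -/
lemma nonpos_of_forall_le_mul {a b : ℝ} (h : ∀ t : ℝ, 0 < t → t ≤ 1 → a ≤ t * b) : a ≤ 0 := by
  by_contra! ha
  have h1 := h 1 one_pos le_rfl
  have hb : 0 < b := by linarith
  have ht : a / (2 * b) ≤ 1 := by
    rw [div_le_one (by positivity)]
    linarith
  have h2 := h (a / (2 * b)) (by positivity) ht
  have h3 : a / (2 * b) * b = a / 2 := by field_simp
  linarith

/-- The variational inequality characterising Frobenius projections onto convex sets. -/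
lemma frobInner_sub_le_zero_of_isProj {n : ℕ} {𝒴 : Set (Matrix (Fin n) (Fin n) ℝ)}
    (h𝒴 : Convex ℝ 𝒴) {W P Q : Matrix (Fin n) (Fin n) ℝ} (hP : P ∈ 𝒴) (hQ : Q ∈ 𝒴)
    (hmin : ∀ Y ∈ 𝒴, frobNorm (W - P) ≤ frobNorm (W - Y)) :
    frobInner (W - P) (Q - P) ≤ 0 := by
  have key : 2 * frobInner (W - P) (Q - P) ≤ 0 := by
    refine nonpos_of_forall_le_mul (b := frobInner (Q - P) (Q - P)) fun t ht ht1 => ?_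
    have hmem : P + t • (Q - P) ∈ 𝒴 := h𝒴.add_smul_sub_mem hP hQ ⟨ht.le, ht1⟩
    have h := pow_le_pow_left₀ (frobNorm_nonneg _) (hmin _ hmem) 2
    rw [show W - (P + t • (Q - P)) = (W - P) - t • (Q - P) by abel, frobNorm_sq, frobNorm_sq] at h
    generalize W - P = U at *
    generalize Q - P = V at *
    simp only [frobInner_sub_left, frobInner_sub_right, frobInner_smul_left,
      frobInner_smul_right, frobInner_comm V U] at h
    nlinarith
  linarith

section AugmentedLagrangian

variable {m n : ℕ}

lemma frobNorm_Gm_sub_le {R : ℝ} {X X' : Matrix (Fin m) (Fin n) ℝ} (hX : specNorm X ≤ R)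
    (hX' : specNorm X' ≤ R) : frobNorm (Gm X - Gm X') ≤ 2 * R * frobNorm (X - X') := by
  have h : Gm X - Gm X' = Xᵀ * (X - X') + (X'ᵀ * (X - X'))ᵀ := by
    simp only [Gm, Matrix.transpose_mul, Matrix.transpose_transpose, Matrix.transpose_sub,
      Matrix.mul_sub]
    abel
  have h1 := frobNorm_transpose_mul_le_specNorm_mul X (X - X')
  have h2 := frobNorm_transpose_mul_le_specNorm_mul X' (X - X')
  have h3 := frobNorm_add_le (Xᵀ * (X - X')) (X'ᵀ * (X - X'))ᵀ
  rw [frobNorm_transpose] at h3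
  rw [h]
  have h4 := mul_le_mul_of_nonneg_right hX (frobNorm_nonneg (X - X'))
  have h5 := mul_le_mul_of_nonneg_right hX' (frobNorm_nonneg (X - X'))
  linarith

lemma Gm_add_smul_sub (X X' : Matrix (Fin m) (Fin n) ℝ) (t : ℝ) :
    Gm (X + t • (X' - X)) =
      (1 - t) • Gm X + t • Gm X' - (t * (1 - t)) • ((X' - X)ᵀ * (X' - X)) := by
  simp only [Gm, Matrix.transpose_add, Matrix.transpose_smul, Matrix.transpose_sub,
    Matrix.mul_sub, Matrix.sub_mul, Matrix.mul_add, Matrix.add_mul, Matrix.smul_mul,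
    Matrix.mul_smul]
  module

lemma frobNorm_Gm_segment_le (X X' : Matrix (Fin m) (Fin n) ℝ) {t : ℝ} (ht : 0 ≤ t)
    (ht1 : t ≤ 1) :
    frobNorm (Gm (X + t • (X' - X))) ^ 2 ≤
      (1 - t) * frobNorm (Gm X) ^ 2 + t * frobNorm (Gm X') ^ 2
        + 2 * (t * (1 - t)) * frobNorm (X' - X) ^ 2 := by
  have hs : 0 ≤ t * (1 - t) := mul_nonneg ht (by linarith)
  have hG := Gm_add_smul_sub X X' t
  have hgram := frobInner_gram_nonneg (X + t • (X' - X)) (X' - X)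
  have htr : frobInner (1 : Matrix (Fin n) (Fin n) ℝ) ((X' - X)ᵀ * (X' - X))
      = frobInner (X' - X) (X' - X) := by simp [frobInner]
  have hin : -frobInner (X' - X) (X' - X) ≤
      frobInner (Gm (X + t • (X' - X))) ((X' - X)ᵀ * (X' - X)) := by
    rw [Gm, frobInner_sub_left _ 1, htr]
    linarith
  have hd := mul_nonneg hs (frobInner_self_nonneg (Gm X' - Gm X))
  have hB := mul_nonneg (mul_self_nonneg (t * (1 - t)))
    (frobInner_self_nonneg ((X' - X)ᵀ * (X' - X)))
  have hin' := mul_le_mul_of_nonneg_left hin hs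
  simp only [frobNorm_sq]
  rw [hG] at hin' ⊢
  generalize (X' - X)ᵀ * (X' - X) = B at *
  generalize frobInner (X' - X) (X' - X) = h at *
  generalize Gm X = P at *
  generalize Gm X' = Q at *
  simp only [frobInner_sub_left, frobInner_sub_right, frobInner_add_left, frobInner_add_right,
    frobInner_smul_left, frobInner_smul_right, frobInner_comm B P, frobInner_comm B Q,
    frobInner_comm Q P] at *
  linear_combination hd + 2 * hin' + hB

/-- A function with `L`-Lipschitz gradient on a convex set is `L`-weakly convex there. -/
lemma segment_le_of_lipschitz_gradient {𝒳 : Set (Matrix (Fin m) (Fin n) ℝ)} (h𝒳 : Convex ℝ 𝒳)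
    {ℓ : Matrix (Fin m) (Fin n) ℝ → ℝ}
    {gradl : Matrix (Fin m) (Fin n) ℝ → Matrix (Fin m) (Fin n) ℝ} {L : ℝ}
    (hgrad : IsGradientOf gradl ℓ)
    (hLip : ∀ X ∈ 𝒳, ∀ X' ∈ 𝒳, frobNorm (gradl X - gradl X') ≤ L * frobNorm (X - X'))
    {X X' : Matrix (Fin m) (Fin n) ℝ} (hX : X ∈ 𝒳) (hX' : X' ∈ 𝒳) {t : ℝ} (ht : 0 ≤ t)
    (ht1 : t ≤ 1) :
    ℓ (X + t • (X' - X)) ≤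
      (1 - t) * ℓ X + t * ℓ X' + L / 2 * (t * (1 - t)) * frobNorm (X' - X) ^ 2 := by
  set H := X' - X with hH
  have hderiv : ∀ s : ℝ, HasDerivAt (fun s : ℝ => ℓ (X + s • H)) (frobInner (gradl (X + s • H)) H)
      s := by
    intro s
    rw [hasDerivAt_iff_isLittleO_nhds_zero, Asymptotics.isLittleO_iff]
    intro c hc
    have hN : 0 < frobNorm H + 1 := by linarith [frobNorm_nonneg H]
    obtain ⟨δ, hδ, hb⟩ := hgrad (X + s • H) (c / (frobNorm H + 1)) (by positivity)
    filter_upwards [Metric.ball_mem_nhds (0 : ℝ) (show 0 < δ / (frobNorm H + 1) by positivity)]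
      with u hu
    rw [mem_ball_zero_iff, Real.norm_eq_abs, lt_div_iff₀ hN] at hu
    have h1 := hb (u • H) (by
      rw [frobNorm_smul]
      nlinarith [abs_nonneg u])
    rw [frobNorm_smul, frobInner_smul_right] at h1
    simp only [Real.norm_eq_abs, smul_eq_mul, add_smul, ← add_assoc]
    refine h1.trans ?_
    rw [div_mul_eq_mul_div, div_le_iff₀ hN]
    nlinarith [mul_nonneg hc.le (abs_nonneg u)]
  have hderiv' : ∀ s : ℝ, HasDerivAt (fun s : ℝ => ℓ (X + s • H) + L / 2 * frobNorm H ^ 2 * s ^ 2)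
      (frobInner (gradl (X + s • H)) H + L * frobNorm H ^ 2 * s) s := by
    intro s
    refine ((hderiv s).add ((hasDerivAt_pow 2 s).const_mul (L / 2 * frobNorm H ^ 2))).congr_deriv ?_
    push_cast
    ring
  have hmem : ∀ s ∈ Set.Icc (0 : ℝ) 1, X + s • H ∈ 𝒳 := fun s hs => h𝒳.add_smul_sub_mem hX hX' hs
  have hconv : ConvexOn ℝ (Set.Icc (0 : ℝ) 1)
      (fun s : ℝ => ℓ (X + s • H) + L / 2 * frobNorm H ^ 2 * s ^ 2) := by
    refine MonotoneOn.convexOn_of_deriv (convex_Icc 0 1)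
      (fun s _ => (hderiv' s).continuousAt.continuousWithinAt)
      (fun s _ => (hderiv' s).differentiableAt.differentiableWithinAt) ?_
    rw [interior_Icc]
    intro a ha b hb hab
    rw [(hderiv' a).deriv, (hderiv' b).deriv]
    have h1 := hLip _ (hmem a (Set.Ioo_subset_Icc_self ha)) _ (hmem b (Set.Ioo_subset_Icc_self hb))
    have h2 := frobInner_le_mul_frobNorm (gradl (X + a • H) - gradl (X + b • H)) H
    rw [show X + a • H - (X + b • H) = (a - b) • H by module, frobNorm_smul,
      abs_of_nonpos (by linarith)] at h1
    rw [frobInner_sub_left] at h2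
    have h3 := mul_le_mul_of_nonneg_right h1 (frobNorm_nonneg H)
    nlinarith
  have h := hconv.2 (Set.left_mem_Icc.2 zero_le_one) (Set.right_mem_Icc.2 zero_le_one)
    (show 0 ≤ 1 - t by linarith) ht (by ring)
  have hXH : X + H = X' := by simp [hH]
  simp only [smul_eq_mul, mul_zero, mul_one, zero_add, zero_smul, add_zero, one_smul, hXH] at h
  nlinarith

lemma Ffun_segment_le {𝒳 : Set (Matrix (Fin m) (Fin n) ℝ)} (h𝒳 : Convex ℝ 𝒳)
    {ℓ g : Matrix (Fin m) (Fin n) ℝ → ℝ}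
    {gradl : Matrix (Fin m) (Fin n) ℝ → Matrix (Fin m) (Fin n) ℝ} {Lℓ Lg ρ RY : ℝ} (r ε : ℝ)
    (hgrad : IsGradientOf gradl ℓ)
    (hLip : ∀ X ∈ 𝒳, ∀ X' ∈ 𝒳, frobNorm (gradl X - gradl X') ≤ Lℓ * frobNorm (X - X'))
    (hg : ConvexOn ℝ 𝒳 (fun X => g X + Lg / 2 * frobNorm X ^ 2)) (hρ : 0 ≤ ρ)
    {Y : Matrix (Fin n) (Fin n) ℝ} (hY : frobNorm Y ≤ RY) (Z : Matrix (Fin m) (Fin n) ℝ)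
    {X X' : Matrix (Fin m) (Fin n) ℝ} (hX : X ∈ 𝒳) (hX' : X' ∈ 𝒳) {t : ℝ} (ht : 0 ≤ t)
    (ht1 : t ≤ 1) :
    Ffun ℓ g ρ r ε (X + t • (X' - X)) Y Z ≤
      (1 - t) * Ffun ℓ g ρ r ε X Y Z + t * Ffun ℓ g ρ r ε X' Y Z
        - (r - (Lℓ + Lg + 2 * RY + 2 * ρ)) / 2 * (t * (1 - t)) * frobNorm (X' - X) ^ 2 := by
  have hs : 0 ≤ t * (1 - t) := mul_nonneg ht (by linarith)
  have hℓ := segment_le_of_lipschitz_gradient h𝒳 hgrad hLip hX hX' ht ht1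
  have hgt : g (X + t • (X' - X)) ≤
      (1 - t) * g X + t * g X' + Lg / 2 * (t * (1 - t)) * frobNorm (X' - X) ^ 2 := by
    have h := hg.2 hX hX' (show 0 ≤ 1 - t by linarith) ht (by ring)
    rw [show (1 - t) • X + t • X' = X + t • (X' - X) by module] at h
    simp only [frobNorm_sq, smul_eq_mul, frobInner_sub_left, frobInner_sub_right,
      frobInner_add_left, frobInner_add_right, frobInner_smul_left, frobInner_smul_right,
      frobInner_comm X' X] at h ⊢
    linear_combination h
  have hlin : frobInner Y (Gm (X + t • (X' - X))) ≤
      (1 - t) * frobInner Y (Gm X) + t * frobInner Y (Gm X')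
        + RY * (t * (1 - t)) * frobNorm (X' - X) ^ 2 := by
    rw [Gm_add_smul_sub]
    have h1 := frobInner_le_mul_frobNorm (-Y) ((X' - X)ᵀ * (X' - X))
    rw [frobNorm_neg, show -Y = (-1 : ℝ) • Y by simp, frobInner_smul_left] at h1
    have h2 := mul_le_mul hY (frobNorm_transpose_mul_self_le (X' - X)) (frobNorm_nonneg _)
      ((frobNorm_nonneg Y).trans hY)
    have h3 := mul_le_mul_of_nonneg_left (h1.trans h2) hs
    simp only [frobInner_sub_right, frobInner_add_right, frobInner_smul_right] at h3 ⊢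
    linear_combination h3
  have hpen := mul_le_mul_of_nonneg_left (frobNorm_Gm_segment_le X X' ht ht1)
    (show 0 ≤ ρ / 2 by linarith)
  have hprox : frobNorm (X + t • (X' - X) - Z) ^ 2 = (1 - t) * frobNorm (X - Z) ^ 2
      + t * frobNorm (X' - Z) ^ 2 - t * (1 - t) * frobNorm (X' - X) ^ 2 := by
    simp only [frobNorm_sq, frobInner_sub_left, frobInner_sub_right,
      frobInner_add_left, frobInner_add_right, frobInner_smul_left, frobInner_smul_right,
      frobInner_comm X' X, frobInner_comm Z X, frobInner_comm Z X']
    ring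
  simp only [Ffun, Lag, hprox]
  linear_combination hℓ + hgt + hlin + hpen

/-- A function that is strongly convex along segments grows quadratically around a minimizer. -/
lemma quadratic_growth_of_isMinOn {𝒳 : Set (Matrix (Fin m) (Fin n) ℝ)} (h𝒳 : Convex ℝ 𝒳)
    {φ : Matrix (Fin m) (Fin n) ℝ → ℝ} {κ : ℝ} {X X' : Matrix (Fin m) (Fin n) ℝ} (hX : X ∈ 𝒳)
    (hX' : X' ∈ 𝒳) (hmin : ∀ W ∈ 𝒳, φ X ≤ φ W)
    (hφ : ∀ t : ℝ, 0 ≤ t → t ≤ 1 → φ (X + t • (X' - X)) ≤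
      (1 - t) * φ X + t * φ X' - κ / 2 * (t * (1 - t)) * frobNorm (X' - X) ^ 2) :
    φ X + κ / 2 * frobNorm (X' - X) ^ 2 ≤ φ X' := by
  have key : φ X + κ / 2 * frobNorm (X' - X) ^ 2 - φ X' ≤ 0 := by
    refine nonpos_of_forall_le_mul (b := κ / 2 * frobNorm (X' - X) ^ 2) fun t ht ht1 => ?_
    have h1 := hmin _ (h𝒳.add_smul_sub_mem hX hX' ⟨ht.le, ht1⟩)
    have h2 := hφ t ht.le ht1
    refine le_of_mul_le_mul_left ?_ ht
    linear_combination h1 + h2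
  linarith

lemma Ffun_sub_Ffun (ℓ g : Matrix (Fin m) (Fin n) ℝ → ℝ) (ρ r ε : ℝ)
    (X Z : Matrix (Fin m) (Fin n) ℝ) (Y Y' : Matrix (Fin n) (Fin n) ℝ) :
    Ffun ℓ g ρ r ε X Y' Z - Ffun ℓ g ρ r ε X Y Z =
      frobInner (Gm X - ε • Y) (Y' - Y) - ε / 2 * frobNorm (Y' - Y) ^ 2 := by
  simp only [Ffun, Lag, frobNorm_sq, frobInner_sub_left, frobInner_sub_right,
    frobInner_smul_left, frobInner_comm Y' Y, frobInner_comm (Gm X)]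
  ring

lemma dfun_eq_of_isMinOn {𝒳 : Set (Matrix (Fin m) (Fin n) ℝ)}
    {ℓ g : Matrix (Fin m) (Fin n) ℝ → ℝ} {ρ r ε : ℝ} {X Z : Matrix (Fin m) (Fin n) ℝ}
    {Y : Matrix (Fin n) (Fin n) ℝ} (hX : X ∈ 𝒳)
    (hmin : ∀ W ∈ 𝒳, Ffun ℓ g ρ r ε X Y Z ≤ Ffun ℓ g ρ r ε W Y Z) :
    dfun 𝒳 ℓ g ρ r ε Y Z = Ffun ℓ g ρ r ε X Y Z :=
  IsLeast.csInf_eq ⟨Set.mem_image_of_mem _ hX, by rintro _ ⟨W, hW, rfl⟩; exact hmin W hW⟩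

end AugmentedLagrangian

/-- Minimizers of `F(·,Y,Z)` with quadratic growth depend Lipschitz continuously on `Y`. -/
lemma frobNorm_sub_le_of_quadratic_growth {m n : ℕ} {ℓ g : Matrix (Fin m) (Fin n) ℝ → ℝ}
    {ρ r ε κ R : ℝ} {X₁ X₂ Z : Matrix (Fin m) (Fin n) ℝ} {Y₁ Y₂ : Matrix (Fin n) (Fin n) ℝ}
    (hκ : 0 < κ) (hX₁ : specNorm X₁ ≤ R) (hX₂ : specNorm X₂ ≤ R)
    (h₁ : Ffun ℓ g ρ r ε X₁ Y₁ Z + κ / 2 * frobNorm (X₂ - X₁) ^ 2 ≤ Ffun ℓ g ρ r ε X₂ Y₁ Z)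
    (h₂ : Ffun ℓ g ρ r ε X₂ Y₂ Z + κ / 2 * frobNorm (X₁ - X₂) ^ 2 ≤ Ffun ℓ g ρ r ε X₁ Y₂ Z) :
    frobNorm (X₁ - X₂) ≤ 2 * R / κ * frobNorm (Y₂ - Y₁) := by
  have hR : 0 ≤ R := (norm_nonneg _).trans hX₁
  have e₁ := Ffun_sub_Ffun ℓ g ρ r ε X₁ Z Y₁ Y₂
  have e₂ := Ffun_sub_Ffun ℓ g ρ r ε X₂ Z Y₁ Y₂
  rw [show X₂ - X₁ = -(X₁ - X₂) by abel, frobNorm_neg] at h₁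
  have hG := (frobInner_le_mul_frobNorm (Gm X₁ - Gm X₂) (Y₂ - Y₁)).trans
    (mul_le_mul_of_nonneg_right (frobNorm_Gm_sub_le hX₁ hX₂) (frobNorm_nonneg (Y₂ - Y₁)))
  have hsplit : frobInner (Gm X₁ - ε • Y₁) (Y₂ - Y₁) - frobInner (Gm X₂ - ε • Y₁) (Y₂ - Y₁)
      = frobInner (Gm X₁ - Gm X₂) (Y₂ - Y₁) := by
    rw [← frobInner_sub_left, sub_sub_sub_cancel_right]
  rw [div_mul_eq_mul_div, le_div_iff₀ hκ]
  rcases (frobNorm_nonneg (X₁ - X₂)).eq_or_lt with h | h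
  · rw [← h, zero_mul]
    exact mul_nonneg (by linarith) (frobNorm_nonneg _)
  · refine le_of_mul_le_mul_left ?_ h
    linear_combination h₁ + h₂ + e₁ - e₂ + hsplit + hG

/-- Dual error bound: `‖X(Y₊(Z),Z) − X(Y(Z),Z)‖_F ≤ ω‖Y₊(Z) − Y‖_F`. -/
theorem dual_error_bound {m n : ℕ} (hmn : n ≤ m)
    (𝒳 : Set (Matrix (Fin m) (Fin n) ℝ)) (𝒴 : Set (Matrix (Fin n) (Fin n) ℝ))
    (ℓ g : Matrix (Fin m) (Fin n) ℝ → ℝ)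
    (gradl : Matrix (Fin m) (Fin n) ℝ → Matrix (Fin m) (Fin n) ℝ)
    (Lℓ Lg ρ RX RY r ε α μρ σ₂ ω : ℝ)
    (h𝒳conv : Convex ℝ 𝒳) (h𝒳cpt : IsCompact 𝒳)
    (h𝒳R : ∀ X ∈ 𝒳, specNorm X ≤ RX)
    (hgrad : IsGradientOf gradl ℓ) (hgradcont : Continuous gradl)
    (hgradLip : ∀ X ∈ 𝒳, ∀ X' ∈ 𝒳, frobNorm (gradl X - gradl X') ≤ Lℓ * frobNorm (X - X'))
    (hgwc : ConvexOn ℝ 𝒳 (fun X => g X + Lg / 2 * frobNorm X ^ 2))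
    (h𝒴symm : ∀ Y ∈ 𝒴, Y.IsSymm) (h𝒴conv : Convex ℝ 𝒴) (h𝒴cpt : IsCompact 𝒴)
    (h𝒴zero : (0 : Matrix (Fin n) (Fin n) ℝ) ∈ 𝒴)
    (h𝒴R : ∀ Y ∈ 𝒴, frobNorm Y ≤ RY)
    (hρ : 0 ≤ ρ) (hε : 0 < ε) (hα : 0 < α)
    (hμρ : μρ = (Lℓ + Lg) + 2 * RY + 2 * ρ) (hr : μρ < r)
    (hσ₂ : σ₂ = 2 * RX / (r - μρ))
    (hω : ω = (1 / Real.sqrt (r - μρ)) * ((1 + (2 * σ₂ * RX + ε) * α) / (Real.sqrt ε * α)))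
    (Xm : Matrix (Fin n) (Fin n) ℝ → Matrix (Fin m) (Fin n) ℝ → Matrix (Fin m) (Fin n) ℝ)
    (hXm : ∀ Y Z, Xm Y Z ∈ 𝒳 ∧ ∀ X' ∈ 𝒳, Ffun ℓ g ρ r ε (Xm Y Z) Y Z ≤ Ffun ℓ g ρ r ε X' Y Z)
    (proj : Matrix (Fin n) (Fin n) ℝ → Matrix (Fin n) (Fin n) ℝ)
    (hproj : ∀ W, proj W ∈ 𝒴 ∧ ∀ Y' ∈ 𝒴, frobNorm (W - proj W) ≤ frobNorm (W - Y')) :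
    ∀ Y ∈ 𝒴, ∀ Z : Matrix (Fin m) (Fin n) ℝ,
      ∀ Ymax ∈ 𝒴, (∀ Y' ∈ 𝒴, dfun 𝒳 ℓ g ρ r ε Y' Z ≤ dfun 𝒳 ℓ g ρ r ε Ymax Z) →
        frobNorm (Xm (proj (Y + α • (Gm (Xm Y Z) - ε • Y))) Z - Xm Ymax Z)
          ≤ ω * frobNorm (proj (Y + α • (Gm (Xm Y Z) - ε • Y)) - Y) := by
  intro Y hY Z Ymax hYmax hopt
  have hκ : 0 < r - μρ := by linarith
  have hgrow : ∀ Y₁ ∈ 𝒴, ∀ X' ∈ 𝒳, Ffun ℓ g ρ r ε (Xm Y₁ Z) Y₁ Z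
      + (r - μρ) / 2 * frobNorm (X' - Xm Y₁ Z) ^ 2 ≤ Ffun ℓ g ρ r ε X' Y₁ Z := by
    intro Y₁ hY₁ X' hX'
    refine quadratic_growth_of_isMinOn (φ := fun X => Ffun ℓ g ρ r ε X Y₁ Z) h𝒳conv (hXm Y₁ Z).1
      hX' (hXm Y₁ Z).2 fun t ht ht1 => ?_
    rw [hμρ]
    exact Ffun_segment_le h𝒳conv r ε hgrad hgradLip hgwc hρ (h𝒴R Y₁ hY₁) Z (hXm Y₁ Z).1 hX' ht ht1
  obtain ⟨hP, hPmin⟩ := hproj (Y + α • (Gm (Xm Y Z) - ε • Y))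
  have hVI := frobInner_sub_le_zero_of_isProj h𝒴conv hP hYmax hPmin
  generalize proj (Y + α • (Gm (Xm Y Z) - ε • Y)) = P at *
  have hR0 := h𝒳R _ (hXm Y Z).1
  have hRP := h𝒳R _ (hXm P Z).1
  have hRX : 0 ≤ RX := (norm_nonneg _).trans hR0
  have hσ : 0 ≤ σ₂ := hσ₂ ▸ div_nonneg (by linarith) hκ.le
  have hLip := frobNorm_sub_le_of_quadratic_growth hκ hRP hR0
    (hgrow P hP _ (hXm Y Z).1) (hgrow Y hY _ (hXm P Z).1)
  have hG := frobNorm_Gm_sub_le hRP hR0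
  rw [← hσ₂, show Y - P = -(P - Y) by abel, frobNorm_neg] at hLip
  -- strong concavity of the dual function between `P` and `Ymax`
  have hdual : (r - μρ) / 2 * frobNorm (Xm P Z - Xm Ymax Z) ^ 2 + ε / 2 * frobNorm (Ymax - P) ^ 2
      ≤ frobInner (Gm (Xm P Z) - ε • P) (Ymax - P) := by
    have h1 := hopt P hP
    rw [dfun_eq_of_isMinOn (hXm P Z).1 (hXm P Z).2,
      dfun_eq_of_isMinOn (hXm Ymax Z).1 (hXm Ymax Z).2] at h1
    have h2 := hgrow Ymax hYmax _ (hXm P Z).1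
    have h3 := Ffun_sub_Ffun ℓ g ρ r ε (Xm P Z) Z P Ymax
    linarith
  -- the projection step controls the dual gradient at `P`
  have hstep : α * frobInner (Gm (Xm P Z) - ε • P) (Ymax - P)
      ≤ (1 + (2 * σ₂ * RX + ε) * α) * frobNorm (P - Y) * frobNorm (Ymax - P) := by
    have h1 := frobInner_le_mul_frobNorm (P - Y) (Ymax - P)
    have h2 := frobInner_le_mul_frobNorm (-(P - Y)) (Ymax - P)
    rw [frobNorm_neg, ← neg_one_smul ℝ (P - Y), frobInner_smul_left] at h2
    have h3 := (frobInner_le_mul_frobNorm (Gm (Xm P Z) - Gm (Xm Y Z)) (Ymax - P)).trans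
      (mul_le_mul_of_nonneg_right (hG.trans (mul_le_mul_of_nonneg_left hLip
        (show 0 ≤ 2 * RX by linarith))) (frobNorm_nonneg _))
    have h4 := mul_le_mul_of_nonneg_left h3 hα.le
    have h5 := mul_le_mul_of_nonneg_left h2 (mul_pos hα hε).le
    generalize Ymax - P = D at *
    simp only [frobInner_sub_left, frobInner_add_left, frobInner_smul_left] at *
    linear_combination hVI + h1 + h4 + h5
  set D := frobNorm (Ymax - P)
  set N := frobNorm (P - Y)
  set Δ := frobNorm (Xm P Z - Xm Ymax Z)
  have hC : 0 ≤ (1 + (2 * σ₂ * RX + ε) * α) := by positivity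
  have hN : 0 ≤ N := frobNorm_nonneg _
  set c := (1 + (2 * σ₂ * RX + ε) * α) / α with hc
  have hc0 : 0 ≤ c := div_nonneg hC hα.le
  have hmain : (r - μρ) / 2 * Δ ^ 2 + ε / 2 * D ^ 2 ≤ c * N * D := by
    refine hdual.trans (le_of_mul_le_mul_left (hstep.trans_eq ?_) hα)
    rw [hc]
    field_simp
  have hω' : ω * N = c * N / (Real.sqrt (r - μρ) * Real.sqrt ε) := by
    rw [hω, hc]
    field_simp
  rw [hω', le_div_iff₀ (by positivity)]
  refine le_of_sq_le_sq ?_ (mul_nonneg hc0 hN)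
  rw [mul_pow, mul_pow, Real.sq_sqrt hκ.le, Real.sq_sqrt hε.le]
  have h1 := mul_le_mul_of_nonneg_left hmain hε.le
  linear_combination 2 * h1 + sq_nonneg (ε * D - c * N)

end
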